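/- Under the 1D-FLP data, the point (ĉ, d̂, ẑ) defined by ĉ i = L / 2 for all i, d̂ i j = 0 for all i, j, and ẑ i j = 1 / 2 for all i ≠ j belongs to the LP relaxation Q₁ᴸᴾ, and the infimum of the objective f over Q₁ᴸᴾ equals 0. -/

import Mathlib

open Finset

/-- The weighted sum `∑_{i<j, i,j ∈ C} p i j * d i j` over pairs of indices in `C`. -/
noncomputable def pairObj {N : ℕ} (p d : Fin N → Fin N → ℝ) (C : Finset (Fin N)) : ℝ :=
  ∑ q ∈ (C ×ˢ C).filter (fun q => q.1 < q.2), p q.1 q.2 * d q.1 q.2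

/-- Membership in the restricted 1D-FLP feasible set `Q₁(C)`; `Q₁ = Q₁(Finset.univ)`. -/
def Mem1D {N : ℕ} (ℓ : Fin N → ℝ) (L : ℝ) (C : Finset (Fin N))
    (c : Fin N → ℝ) (d z : Fin N → Fin N → ℝ) : Prop :=
  (∀ i ∈ C, ∀ j ∈ C, i ≠ j → d i j = d j i) ∧
  (∀ i ∈ C, ∀ j ∈ C, i ≠ j → d i j ≥ c i - c j) ∧
  (∀ i ∈ C, ∀ j ∈ C, i ≠ j → c i + ℓ i ≤ c j - ℓ j + L * (1 - z i j)) ∧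
  (∀ i ∈ C, ∀ j ∈ C, i ≠ j → z i j + z j i = 1) ∧
  (∀ i ∈ C, 0 ≤ c i ∧ c i ≤ L) ∧
  (∀ i ∈ C, ∀ j ∈ C, i ≠ j → z i j ∈ ({0, 1} : Set ℝ))

/-- `γ(C)`: the optimal (infimum) value of the 1D-FLP restricted to the components `C`. -/
noncomputable def gamma1 {N : ℕ} (ℓ : Fin N → ℝ) (L : ℝ) (p : Fin N → Fin N → ℝ)
    (C : Finset (Fin N)) : ℝ :=
  sInf {v | ∃ c d z, Mem1D ℓ L C c d z ∧ v = pairObj p d C}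

/-- Membership in the LP relaxation `Q₁ᴸᴾ` of the 1D-FLP formulation. -/
def Mem1DLP {N : ℕ} (ℓ : Fin N → ℝ) (L : ℝ)
    (c : Fin N → ℝ) (d z : Fin N → Fin N → ℝ) : Prop :=
  (∀ i j : Fin N, i ≠ j → d i j = d j i) ∧
  (∀ i j : Fin N, i ≠ j → d i j ≥ c i - c j) ∧
  (∀ i j : Fin N, i ≠ j → c i + ℓ i ≤ c j - ℓ j + L * (1 - z i j)) ∧
  (∀ i j : Fin N, i ≠ j → z i j + z j i = 1) ∧
  (∀ i : Fin N, 0 ≤ c i ∧ c i ≤ L) ∧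
  (∀ i j : Fin N, i ≠ j → 0 ≤ z i j ∧ z i j ≤ 1)

theorem Mem1DLP.nonneg {N : ℕ} {ℓ : Fin N → ℝ} {L : ℝ} {c : Fin N → ℝ}
    {d z : Fin N → Fin N → ℝ} (h : Mem1DLP ℓ L c d z) {i j : Fin N} (hij : i ≠ j) :
    0 ≤ d i j := by
  obtain ⟨hsymm, hdist, -⟩ := h
  linarith [hsymm i j hij, hdist i j hij, hdist j i hij.symm]

theorem Mem1DLP.pairObj_nonneg {N : ℕ} {ℓ : Fin N → ℝ} {L : ℝ} {c : Fin N → ℝ}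
    {d z : Fin N → Fin N → ℝ} (h : Mem1DLP ℓ L c d z) {p : Fin N → Fin N → ℝ}
    (hp : ∀ i j, 0 ≤ p i j) (C : Finset (Fin N)) : 0 ≤ pairObj p d C :=
  Finset.sum_nonneg fun q hq =>
    mul_nonneg (hp q.1 q.2) (h.nonneg (Finset.mem_filter.1 hq).2.ne)

theorem mem1DLP_midpoint {N : ℕ} {ℓ : Fin N → ℝ} (hℓ : ∀ i, 0 ≤ ℓ i) {L : ℝ}
    (hL : 2 * ∑ i, ℓ i ≤ L) :
    Mem1DLP ℓ L (fun _ => L / 2) (fun _ _ => 0) (fun _ _ => 1 / 2) := by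
  have hsum : 0 ≤ ∑ i, ℓ i := Finset.sum_nonneg fun i _ => hℓ i
  refine ⟨fun _ _ _ => rfl, fun _ _ _ => by simp, fun i j hij => ?_, fun _ _ _ => by norm_num,
    fun _ => ⟨by linarith, by linarith⟩, fun _ _ _ => by norm_num⟩
  have hpair : ℓ i + ℓ j ≤ ∑ k, ℓ k :=
    Finset.add_le_sum (fun k _ => hℓ k) (Finset.mem_univ i) (Finset.mem_univ j) hij
  linarith

/-- the LP relaxation of the 1D-FLP formulation has optimal value zero. -/
theorem oneDFLP_LP_relaxation_value_zero {N : ℕ} (hN : 2 ≤ N)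
    (ℓ : Fin N → ℝ) (hℓ : ∀ i, 0 < ℓ i)
    (p : Fin N → Fin N → ℝ) (hpsym : ∀ i j, p i j = p j i)
    (hpnn : ∀ i j, 0 ≤ p i j) (hpdiag : ∀ i, p i i = 0)
    (L : ℝ) (hL : L ≥ 2 * ∑ i, ℓ i) :
    Mem1DLP ℓ L (fun _ => L / 2) (fun _ _ => 0) (fun _ _ => 1 / 2) ∧
    sInf {v | ∃ c d z, Mem1DLP ℓ L c d z ∧ v = pairObj p d Finset.univ} = 0 := by
  have hmem := mem1DLP_midpoint (fun i => (hℓ i).le) hL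
  refine ⟨hmem, IsLeast.csInf_eq ⟨⟨_, _, _, hmem, by simp [pairObj]⟩, ?_⟩⟩
  rintro v ⟨c, d, z, h, rfl⟩
  exact h.pairObj_nonneg hpnn Finset.univ
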